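/- Let p_1, p_2, … be an enumeration of the odd primes, and let M be the Puiseux monoid generated by {1/2^n : n ∈ ℕ} ∪ {1/p_n : n ∈ ℕ}. Then 𝒜(M) = {1/p_n : n ∈ ℕ}, and for every n ∈ ℕ the element 1/2^n cannot be written as a finite sum of atoms of M; in particular, M is a non-atomic Puiseux monoid with infinitely many atoms. -/

import Mathlib

/-- `a` is an atom of the Puiseux monoid `M`. -/
def PMAtom (M : AddSubmonoid ℚ) (a : ℚ) : Prop :=
  a ∈ M ∧ a ≠ 0 ∧ ∀ x ∈ M, ∀ y ∈ M, a = x + y → x = 0 ∨ y = 0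

/-- The set of atoms of `M`. -/
def PMAtoms (M : AddSubmonoid ℚ) : Set ℚ := {a | PMAtom M a}

/-- `M` is atomic: every element of `M` is a finite sum of atoms of `M`. -/
def PMAtomic (M : AddSubmonoid ℚ) : Prop :=
  ∀ m ∈ M, ∃ l : Multiset ℚ, (∀ a ∈ l, PMAtom M a) ∧ l.sum = m

/-- If a prime does not divide the denominators of two rationals, it does not divide the
denominator of their sum. -/
lemma Rat.not_dvd_den_add {q : ℕ} (hq : q.Prime) {x y : ℚ} (hx : ¬ q ∣ x.den)
    (hy : ¬ q ∣ y.den) : ¬ q ∣ (x + y).den := fun h =>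
  (hq.dvd_mul.1 (h.trans (Rat.add_den_dvd x y))).elim hx hy

lemma Rat.not_dvd_den_multiset_sum {q : ℕ} (hq : q.Prime) (l : Multiset ℚ)
    (hl : ∀ a ∈ l, ¬ q ∣ a.den) : ¬ q ∣ l.sum.den :=
  Multiset.sum_induction (fun x : ℚ => ¬ q ∣ x.den) l
    (fun _ _ => Rat.not_dvd_den_add hq) (by simpa using hq.ne_one) hl

lemma Rat.den_one_div_natCast {n : ℕ} (hn : 0 < n) : (1 / (n : ℚ)).den = n := by
  rw [one_div, Rat.inv_natCast_den_of_pos hn]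

lemma Rat.den_one_div_two_pow (n : ℕ) : (1 / 2 ^ n : ℚ).den = 2 ^ n := by
  have h := Rat.den_one_div_natCast (n := 2 ^ n) (by positivity)
  rwa [Nat.cast_pow, Nat.cast_ofNat] at h

/-- The atoms of a Puiseux monoid lie in every generating set. -/
lemma PMAtom.mem_of_closure {S : Set ℚ} {a : ℚ} (ha : PMAtom (AddSubmonoid.closure S) a) :
    a ∈ S := by
  obtain ⟨haM, ha0, hadd⟩ := ha
  induction haM using AddSubmonoid.closure_induction with
  | mem x hx => exact hx
  | zero => exact absurd rfl ha0
  | add x y hx hy ihx ihy =>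
    rcases hadd x hx y hy rfl with rfl | rfl
    · rw [zero_add] at ha0 hadd ⊢
      exact ihy ha0 hadd
    · rw [add_zero] at ha0 hadd ⊢
      exact ihx ha0 hadd

/-- In a monoid generated by nonnegative rationals whose denominators are all prime to `q`, except
for the generator `1 / q`, every element splits as a multiple of `1 / q` plus a nonnegative rational
with denominator prime to `q`. -/
lemma exists_eq_natCast_div_add_of_mem_closure {S : Set ℚ} {q : ℕ} (hq : q.Prime)
    (hS : ∀ x ∈ S, 0 ≤ x ∧ (x = 1 / q ∨ ¬ q ∣ x.den)) {x : ℚ}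
    (hx : x ∈ AddSubmonoid.closure S) :
    ∃ (c : ℕ) (y : ℚ), 0 ≤ y ∧ ¬ q ∣ y.den ∧ x = c / q + y := by
  have h0 : ¬ q ∣ (0 : ℚ).den := by simpa using hq.ne_one
  induction hx using AddSubmonoid.closure_induction with
  | mem x hx =>
    obtain ⟨hx0, rfl | hd⟩ := hS x hx
    · exact ⟨1, 0, le_rfl, h0, by simp⟩
    · exact ⟨0, x, hx0, hd, by simp⟩
  | zero => exact ⟨0, 0, le_rfl, h0, by simp⟩
  | add x y hx hy ihx ihy =>
    obtain ⟨c, x', hx', hdx, rfl⟩ := ihx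
    obtain ⟨d, y', hy', hdy, rfl⟩ := ihy
    exact ⟨c + d, x' + y', add_nonneg hx' hy', Rat.not_dvd_den_add hq hdx hdy,
      by push_cast; ring⟩

lemma pmAtom_one_div_prime {S : Set ℚ} {q : ℕ} (hq : q.Prime)
    (hS : ∀ x ∈ S, 0 ≤ x ∧ (x = 1 / q ∨ ¬ q ∣ x.den)) (hqS : 1 / (q : ℚ) ∈ S) :
    PMAtom (AddSubmonoid.closure S) (1 / q) := by
  have hq0 : (0 : ℚ) < q := by exact_mod_cast hq.pos
  refine ⟨AddSubmonoid.subset_closure hqS, by positivity, fun x hx y hy hxy => ?_⟩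
  obtain ⟨c, x', hx', hdx, rfl⟩ := exists_eq_natCast_div_add_of_mem_closure hq hS hx
  obtain ⟨d, y', hy', hdy, rfl⟩ := exists_eq_natCast_div_add_of_mem_closure hq hS hy
  have hsum : 1 = (c + d : ℚ) + q * (x' + y') := by
    field_simp at hxy
    linarith
  have hcd : c + d ≤ 1 := by
    have : (0 : ℚ) ≤ q * (x' + y') := by positivity
    have : ((c + d : ℕ) : ℚ) ≤ 1 := by push_cast; linarith
    exact_mod_cast this
  have hcd0 : c + d ≠ 0 := by
    intro h
    obtain ⟨rfl, rfl⟩ := Nat.add_eq_zero_iff.1 h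
    apply Rat.not_dvd_den_add hq hdx hdy
    have : x' + y' = 1 / (q : ℚ) := by simpa using hxy.symm
    rw [this, Rat.den_one_div_natCast hq.pos]
  have hcd1 : (c + d : ℚ) = 1 := by exact_mod_cast (by omega : c + d = 1)
  have hxy0 : x' + y' = 0 := by
    rw [hcd1, left_eq_add] at hsum
    exact (mul_eq_zero.1 hsum).resolve_left hq0.ne'
  obtain ⟨rfl, rfl⟩ := (add_eq_zero_iff_of_nonneg hx' hy').1 hxy0
  rcases (by omega : c = 0 ∨ d = 0) with rfl | rfl
  · left; simp
  · right; simp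

/-- Let `p_1, p_2, …` enumerate the odd primes, and let
`M = ⟨{1/2^n : n ∈ ℕ} ∪ {1/p_n : n ∈ ℕ}⟩`. Then `𝒜(M) = {1/p_n : n ∈ ℕ}`, and no `1/2^n`
is a finite sum of atoms of `M`; in particular `M` is a non-atomic Puiseux monoid with
infinitely many atoms. -/
theorem nonatomic_with_infinitely_many_atoms (p : ℕ → ℕ)
    (hp : ∀ n, (p n).Prime ∧ Odd (p n)) (hinj : Function.Injective p)
    (hsurj : ∀ q : ℕ, q.Prime → Odd q → ∃ n, p n = q)
    (M : AddSubmonoid ℚ)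
    (hM : M = AddSubmonoid.closure
      ({x : ℚ | ∃ n : ℕ, 0 < n ∧ x = 1 / 2 ^ n} ∪
       {x : ℚ | ∃ n : ℕ, x = 1 / (p n : ℚ)})) :
    PMAtoms M = {x : ℚ | ∃ n : ℕ, x = 1 / (p n : ℚ)} ∧
    (∀ n : ℕ, 0 < n →
      ¬ ∃ l : Multiset ℚ, (∀ a ∈ l, PMAtom M a) ∧ l.sum = 1 / 2 ^ n) ∧
    ¬ PMAtomic M ∧ (PMAtoms M).Infinite := by
  subst hM
  set S : Set ℚ := {x : ℚ | ∃ n : ℕ, 0 < n ∧ x = 1 / 2 ^ n} ∪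
    {x : ℚ | ∃ n : ℕ, x = 1 / (p n : ℚ)}
  have hden (n : ℕ) : (1 / (p n : ℚ)).den = p n := Rat.den_one_div_natCast (hp n).1.pos
  have hpow (n : ℕ) (hn : 0 < n) : (1 / 2 ^ n : ℚ) ∈ AddSubmonoid.closure S :=
    AddSubmonoid.subset_closure (Or.inl ⟨n, hn, rfl⟩)
  have hatoms : PMAtoms (AddSubmonoid.closure S) = {x : ℚ | ∃ n : ℕ, x = 1 / (p n : ℚ)} := by
    ext a
    constructor
    · intro ha
      rcases PMAtom.mem_of_closure ha with ⟨n, hn, rfl⟩ | h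
      · have hhalf := ha.2.2 _ (hpow (n + 1) n.succ_pos) _ (hpow (n + 1) n.succ_pos)
          (by rw [pow_succ]; field_simp; norm_num)
        exact absurd hhalf (by simp)
      · exact h
    · rintro ⟨n, rfl⟩
      refine pmAtom_one_div_prime (hp n).1 ?_ (Or.inr ⟨n, rfl⟩)
      rintro x (⟨m, hm, rfl⟩ | ⟨m, rfl⟩)
      · refine ⟨by positivity, Or.inr fun h => ?_⟩
        rw [Rat.den_one_div_two_pow] at h
        have h2 := (Nat.prime_dvd_prime_iff_eq (hp n).1 Nat.prime_two).1
          ((hp n).1.dvd_of_dvd_pow h)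
        exact absurd (h2 ▸ (hp n).2) (by decide)
      · refine ⟨by positivity, or_iff_not_imp_right.2 fun h => ?_⟩
        rw [not_not, hden, Nat.prime_dvd_prime_iff_eq (hp n).1 (hp m).1] at h
        rw [h]
  have hnot (n : ℕ) (hn : 0 < n) : ¬ ∃ l : Multiset ℚ,
      (∀ a ∈ l, PMAtom (AddSubmonoid.closure S) a) ∧ l.sum = 1 / 2 ^ n := by
    rintro ⟨l, hl, hsum⟩
    refine Rat.not_dvd_den_multiset_sum Nat.prime_two l (fun a ha => ?_) ?_
    · obtain ⟨m, rfl⟩ := hatoms.subset (hl a ha)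
      rw [hden]
      exact (hp m).2.not_two_dvd_nat
    · rw [hsum, Rat.den_one_div_two_pow]
      exact dvd_pow_self 2 hn.ne'
  refine ⟨hatoms, hnot, fun h => hnot 1 one_pos (h _ (hpow 1 one_pos)), ?_⟩
  rw [hatoms]
  refine Set.infinite_of_injective_forall_mem (f := fun n => 1 / (p n : ℚ)) (fun m n h => ?_)
    fun n => ⟨n, rfl⟩
  have := congrArg Rat.den h
  simp only [hden] at this
  exact hinj this
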